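/- arXiv:1611.08423 — 3 statements merged into one kernel-verified Lean document; each statement's English description precedes it below -/
import Mathlib

section
/- Let x, y > 0 and σ > 0. Then B_σ(x, y)² ≤ B(x, y) · B_{2σ}(x, y), where B(x, y) = B₀(x, y) is the classical Euler beta function. -/
open Real intervalIntegral

/-- The extended beta function `B_σ(x, y) = ∫₀¹ t^(x-1) (1-t)^(y-1) exp(-σ/(t(1-t))) dt`. -/
noncomputable def extBeta (σ x y : ℝ) : ℝ :=
  ∫ t in (0:ℝ)..1, t ^ (x - 1) * (1 - t) ^ (y - 1) * Real.exp (-σ / (t * (1 - t)))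

open MeasureTheory

lemma intervalIntegrable_beta {x y : ℝ} (hx : 0 < x) (hy : 0 < y) :
    IntervalIntegrable (fun t : ℝ => t ^ (x - 1) * (1 - t) ^ (y - 1)) volume 0 1 := by
  have h := Complex.betaIntegral_convergent (u := x) (v := y) (by simpa) (by simpa)
  rw [intervalIntegrable_iff_integrableOn_Ioc_of_le zero_le_one] at h ⊢
  refine IntegrableOn.congr_fun h.re (fun t ht => ?_) measurableSet_Ioc
  have key : (t : ℂ) ^ ((x : ℂ) - 1) * (1 - (t : ℂ)) ^ ((y : ℂ) - 1) =
      ((t ^ (x - 1) * (1 - t) ^ (y - 1) : ℝ) : ℂ) := by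
    push_cast [Complex.ofReal_cpow ht.1.le, Complex.ofReal_cpow (sub_nonneg.2 ht.2)]
    rfl
  simp only [key]
  exact Complex.ofReal_re _

lemma intervalIntegrable_extBeta {x y σ : ℝ} (hx : 0 < x) (hy : 0 < y) (hσ : 0 ≤ σ) :
    IntervalIntegrable
      (fun t : ℝ => t ^ (x - 1) * (1 - t) ^ (y - 1) * Real.exp (-σ / (t * (1 - t))))
      volume 0 1 := by
  have h := intervalIntegrable_beta hx hy
  rw [intervalIntegrable_iff_integrableOn_Ioc_of_le zero_le_one] at h ⊢
  refine Integrable.mul_bdd (c := 1) h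
    (Measurable.aestronglyMeasurable (by fun_prop)) ?_
  filter_upwards [ae_restrict_mem measurableSet_Ioc] with t ht
  rw [Real.norm_of_nonneg (Real.exp_nonneg _), Real.exp_le_one_iff]
  exact div_nonpos_of_nonpos_of_nonneg (neg_nonpos.2 hσ)
    (mul_nonneg ht.1.le (sub_nonneg.2 ht.2))

/-- B_σ(x,y)² ≤ B(x,y)·B_{2σ}(x,y), where B = B₀ is the classical beta function. -/
theorem extBeta_sq_le (x y σ : ℝ) (hx : 0 < x) (hy : 0 < y) (hσ : 0 < σ) :
    extBeta σ x y ^ 2 ≤ extBeta 0 x y * extBeta (2 * σ) x y := by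
  have quadratic_nonneg : ∀ s : ℝ, 0 ≤ extBeta 0 x y * (s * s) +
      (-2 * extBeta σ x y) * s + extBeta (2 * σ) x y := by
    intro s
    have h₀ := (intervalIntegrable_extBeta hx hy le_rfl).mul_const (s * s)
    have h₁ := ((intervalIntegrable_extBeta hx hy hσ.le).const_mul (-2)).mul_const s
    have h₂ := intervalIntegrable_extBeta hx hy (mul_nonneg zero_le_two hσ.le)
    unfold extBeta
    rw [← intervalIntegral.integral_const_mul, ← intervalIntegral.integral_mul_const,
      ← intervalIntegral.integral_mul_const, ← intervalIntegral.integral_add h₀ h₁,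
      ← intervalIntegral.integral_add (h₀.add h₁) h₂]
    refine intervalIntegral.integral_nonneg zero_le_one fun t ht => ?_
    have hw : 0 ≤ t ^ (x - 1) * (1 - t) ^ (y - 1) :=
      mul_nonneg (Real.rpow_nonneg ht.1 _) (Real.rpow_nonneg (sub_nonneg.2 ht.2) _)
    have he : Real.exp (-(2 * σ) / (t * (1 - t))) = Real.exp (-σ / (t * (1 - t))) ^ 2 := by
      rw [← Real.exp_nat_mul]
      congr 1
      push_cast
      ring
    rw [he, neg_zero, zero_div, Real.exp_zero]
    linarith [mul_nonneg hw (sq_nonneg (s - Real.exp (-σ / (t * (1 - t)))))]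
  have h := discrim_le_zero quadratic_nonneg
  rw [discrim] at h
  linarith
end

section
/- For each fixed x, y > 0, the function σ ↦ B_σ(x−1, y−1) / B_σ(x, y) is decreasing on (0, ∞). -/
open Real intervalIntegral

open MeasureTheory Set in
/-- The beta density `t^(x-1) (1-t)^(y-1)` is integrable on `(0, 1)`. -/
theorem integrableOn_rpow_mul_one_sub_rpow {x y : ℝ} (hx : 0 < x) (hy : 0 < y) :
    IntegrableOn (fun t : ℝ => t ^ (x - 1) * (1 - t) ^ (y - 1)) (Ioo 0 1) := by
  have h := Complex.betaIntegral_convergent (u := x) (v := y) (by simpa) (by simpa)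
  rw [intervalIntegrable_iff_integrableOn_Ioo_of_le zero_le_one] at h
  refine IntegrableOn.congr_fun h.norm (fun t ht => ?_) measurableSet_Ioo
  have h1 : 0 < 1 - t := sub_pos.2 ht.2
  have e1 : ((t : ℂ)) ^ ((x : ℂ) - 1) = ((t ^ (x - 1) : ℝ) : ℂ) := by
    rw [Complex.ofReal_cpow ht.1.le]; push_cast; rfl
  have e2 : (1 - (t : ℂ)) ^ ((y : ℂ) - 1) = (((1 - t) ^ (y - 1) : ℝ) : ℂ) := by
    rw [Complex.ofReal_cpow h1.le]; push_cast; rfl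
  simp only [e1, e2]
  rw [← Complex.ofReal_mul, Complex.norm_real, Real.norm_of_nonneg]
  exact mul_nonneg (rpow_nonneg ht.1.le _) (rpow_nonneg h1.le _)

open MeasureTheory Set in
/-- The integrand of `extBeta σ x y` is integrable on `(0, 1)`. -/
theorem integrableOn_extBeta {σ x y : ℝ} (hσ : 0 < σ) (hx : 0 < x) (hy : 0 < y) :
    IntegrableOn (fun t : ℝ => t ^ (x - 1) * (1 - t) ^ (y - 1) * exp (-σ / (t * (1 - t))))
      (Ioo 0 1) := by
  refine (integrableOn_rpow_mul_one_sub_rpow hx hy).mono'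
    (Measurable.aestronglyMeasurable (by fun_prop))
    ((ae_restrict_iff' measurableSet_Ioo).2 (.of_forall fun t ht => ?_))
  have h1 : 0 < 1 - t := sub_pos.2 ht.2
  have ht0 := ht.1
  rw [Real.norm_of_nonneg (by positivity)]
  refine mul_le_of_le_one_right (by positivity) (exp_le_one_iff.2 ?_)
  exact div_nonpos_of_nonpos_of_nonneg (by linarith) (by positivity)

open MeasureTheory Set in
/-- The integrand of `extBeta σ x y` remains integrable after multiplication by `1/(t(1-t))`. -/
theorem integrableOn_inv_mul_extBeta {σ x y : ℝ} (hσ : 0 < σ) (hx : 0 < x) (hy : 0 < y) :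
    IntegrableOn (fun t : ℝ => (t * (1 - t))⁻¹ *
      (t ^ (x - 1) * (1 - t) ^ (y - 1) * exp (-σ / (t * (1 - t))))) (Ioo 0 1) := by
  refine ((integrableOn_rpow_mul_one_sub_rpow hx hy).const_mul σ⁻¹).mono'
    (Measurable.aestronglyMeasurable (by fun_prop))
    ((ae_restrict_iff' measurableSet_Ioo).2 (.of_forall fun t ht => ?_))
  have h1 : 0 < 1 - t := sub_pos.2 ht.2
  have ht0 := ht.1
  rw [Real.norm_of_nonneg (by positivity)]
  have key : (t * (1 - t))⁻¹ * exp (-σ / (t * (1 - t))) ≤ σ⁻¹ := by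
    rw [neg_div, exp_neg, ← div_eq_mul_inv, div_le_iff₀ (exp_pos _)]
    have h2 := add_one_le_exp (σ / (t * (1 - t)))
    calc (t * (1 - t))⁻¹ = σ⁻¹ * (σ / (t * (1 - t))) := by field_simp
      _ ≤ σ⁻¹ * exp (σ / (t * (1 - t))) := by gcongr; linarith
  calc _ = (t * (1 - t))⁻¹ * exp (-σ / (t * (1 - t))) * (t ^ (x - 1) * (1 - t) ^ (y - 1)) := by
        ring
    _ ≤ _ := by gcongr

open MeasureTheory Set in
theorem extBeta_eq_integral_Ioo (σ x y : ℝ) : extBeta σ x y =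
    ∫ t in Ioo (0 : ℝ) 1, t ^ (x - 1) * (1 - t) ^ (y - 1) * exp (-σ / (t * (1 - t))) := by
  rw [extBeta, integral_of_le zero_le_one, integral_Ioc_eq_integral_Ioo]

open MeasureTheory Set in
theorem extBeta_sub_one_eq_integral_Ioo (σ x y : ℝ) : extBeta σ (x - 1) (y - 1) =
    ∫ t in Ioo (0 : ℝ) 1, (t * (1 - t))⁻¹ *
      (t ^ (x - 1) * (1 - t) ^ (y - 1) * exp (-σ / (t * (1 - t)))) := by
  rw [extBeta_eq_integral_Ioo]
  refine setIntegral_congr_fun measurableSet_Ioo fun t ht => ?_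
  have h1 : 0 < 1 - t := sub_pos.2 ht.2
  simp only [rpow_sub_one ht.1.ne' (x - 1), rpow_sub_one h1.ne' (y - 1)]
  rw [mul_inv]
  ring

open MeasureTheory Set in
theorem extBeta_pos {σ x y : ℝ} (hσ : 0 < σ) (hx : 0 < x) (hy : 0 < y) : 0 < extBeta σ x y := by
  refine intervalIntegral_pos_of_pos_on
    ((intervalIntegrable_iff_integrableOn_Ioo_of_le zero_le_one).2
      (integrableOn_extBeta hσ hx hy)) (fun t ht => ?_) one_pos
  have h1 : 0 < 1 - t := sub_pos.2 ht.2
  have ht0 := ht.1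
  positivity

open MeasureTheory Set in
/-- For fixed x, y > 0, σ ↦ B_σ(x-1, y-1)/B_σ(x, y) is decreasing on (0, ∞). -/
theorem extBeta_ratio_antitone (x y : ℝ) (hx : 0 < x) (hy : 0 < y) :
    AntitoneOn (fun σ => extBeta σ (x - 1) (y - 1) / extBeta σ x y) (Set.Ioi 0) := by
  intro a ha b hb hab
  simp only [mem_Ioi] at ha hb
  have ha0 := extBeta_pos ha hx hy
  simp only
  rw [div_le_iff₀ (extBeta_pos hb hx hy)]
  set m := extBeta a (x - 1) (y - 1) / extBeta a x y with hm
  have hma : extBeta a (x - 1) (y - 1) - m * extBeta a x y = 0 := by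
    rw [hm, div_mul_cancel₀ _ ha0.ne', sub_self]
  -- Chebyshev's argument: compare the weight `exp (-(b - a) w)` with its value at the mean `m`.
  set c := exp (-(b - a) * m) with hc
  suffices h : extBeta b (x - 1) (y - 1) - m * extBeta b x y ≤
      c * (extBeta a (x - 1) (y - 1) - m * extBeta a x y) by
    rw [hma, mul_zero] at h
    linarith
  have iA := integrableOn_extBeta ha hx hy
  have iB := integrableOn_extBeta hb hx hy
  have jA := integrableOn_inv_mul_extBeta ha hx hy
  have jB := integrableOn_inv_mul_extBeta hb hx hy
  rw [extBeta_sub_one_eq_integral_Ioo, extBeta_sub_one_eq_integral_Ioo,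
    extBeta_eq_integral_Ioo b, extBeta_eq_integral_Ioo a,
    ← MeasureTheory.integral_const_mul m, ← MeasureTheory.integral_const_mul m,
    ← MeasureTheory.integral_sub jB (iB.const_mul m),
    ← MeasureTheory.integral_sub jA (iA.const_mul m), ← MeasureTheory.integral_const_mul c]
  refine setIntegral_mono_on (jB.sub (iB.const_mul m)) ((jA.sub (iA.const_mul m)).const_mul c)
    measurableSet_Ioo fun t ht => ?_
  have h1 : 0 < 1 - t := sub_pos.2 ht.2
  have ht0 := ht.1
  have hexp : exp (-b / (t * (1 - t))) =
      exp (-(b - a) * (t * (1 - t))⁻¹) * exp (-a / (t * (1 - t))) := by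
    rw [← exp_add]; congr 1; ring
  rw [hexp]
  set w := (t * (1 - t))⁻¹
  have hF : 0 ≤ t ^ (x - 1) * (1 - t) ^ (y - 1) * exp (-a / (t * (1 - t))) := by positivity
  have hw : (w - m) * (exp (-(b - a) * w) - c) ≤ 0 := by
    rcases le_total w m with h | h
    · refine mul_nonpos_of_nonpos_of_nonneg (by linarith) (sub_nonneg.2 (exp_le_exp.2 ?_))
      nlinarith
    · refine mul_nonpos_of_nonneg_of_nonpos (by linarith) (sub_nonpos.2 (exp_le_exp.2 ?_))
      nlinarith
  have := mul_nonpos_of_nonneg_of_nonpos hF hw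
  linear_combination this
end

section
/- Let c > b > 0 and let x ∈ ℝ be fixed. Then the function σ ↦ Φ_σ(b; c; x) is log-convex on (0, ∞); that is, for all σ₁, σ₂ > 0 and α ∈ [0, 1], Φ_{α σ₁ + (1−α) σ₂}(b; c; x) ≤ (Φ_{σ₁}(b; c; x))^α · (Φ_{σ₂}(b; c; x))^{1−α}. -/
open Real intervalIntegral

/-- The classical Euler beta function. -/
noncomputable def classicalBeta (u v : ℝ) : ℝ :=
  Real.Gamma u * Real.Gamma v / Real.Gamma (u + v)

/-- The extended confluent hypergeometric function. -/
noncomputable def extCHF (σ b c x : ℝ) : ℝ :=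
  (1 / classicalBeta b (c - b)) *
    ∫ t in (0:ℝ)..1, t ^ (b - 1) * (1 - t) ^ (c - b - 1) *
      Real.exp (x * t - σ / (t * (1 - t)))

open MeasureTheory in
/-- **Hölder's inequality** for weighted geometric means of nonnegative integrable functions. -/
theorem integral_rpow_mul_rpow_one_sub_le {Ω : Type*} [MeasurableSpace Ω] {μ : Measure Ω}
    {f g : Ω → ℝ} (hf : Integrable f μ) (hg : Integrable g μ) (hf0 : 0 ≤ᵐ[μ] f)
    (hg0 : 0 ≤ᵐ[μ] g) {α : ℝ} (hα : α ∈ Set.Icc (0 : ℝ) 1) :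
    ∫ a, f a ^ α * g a ^ (1 - α) ∂μ ≤ (∫ a, f a ∂μ) ^ α * (∫ a, g a ∂μ) ^ (1 - α) := by
  rcases hα.1.eq_or_lt with rfl | h0
  · simp
  rcases hα.2.eq_or_lt with rfl | h1
  · simp
  have h1' : 0 < 1 - α := sub_pos.2 h1
  have memLp_rpow : ∀ {h : Ω → ℝ}, Integrable h μ → 0 ≤ᵐ[μ] h → ∀ {s : ℝ}, 0 < s →
      MemLp (fun a => h a ^ s) (ENNReal.ofReal s⁻¹) μ := by
    intro h hh hh0 s hs
    refine (integrable_norm_rpow_iff (hh.1.aemeasurable.pow_const s).aestronglyMeasurable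
      (by simpa using hs) ENNReal.ofReal_ne_top).1 (hh.congr ?_)
    filter_upwards [hh0] with a ha
    rw [ENNReal.toReal_ofReal (inv_nonneg.2 hs.le), norm_of_nonneg (rpow_nonneg ha _),
      rpow_rpow_inv ha hs.ne']
  have hpq : (α⁻¹).HolderConjugate (1 - α)⁻¹ :=
    Real.HolderConjugate.inv_inv h0 h1' (by ring)
  have key := integral_mul_le_Lp_mul_Lq_of_nonneg hpq
    (hf0.mono fun a ha => rpow_nonneg ha α) (hg0.mono fun a ha => rpow_nonneg ha (1 - α))
    (memLp_rpow hf hf0 h0) (memLp_rpow hg hg0 h1')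
  have hF : ∫ a, (f a ^ α) ^ α⁻¹ ∂μ = ∫ a, f a ∂μ :=
    integral_congr_ae (hf0.mono fun a ha => rpow_rpow_inv ha h0.ne')
  have hG : ∫ a, (g a ^ (1 - α)) ^ (1 - α)⁻¹ ∂μ = ∫ a, g a ∂μ :=
    integral_congr_ae (hg0.mono fun a ha => rpow_rpow_inv ha h1'.ne')
  simpa only [hF, hG, one_div, inv_inv] using key

open MeasureTheory in
theorem integrableOn_rpow_mul_one_sub_rpow_s13 {u v : ℝ} (hu : 0 < u) (hv : 0 < v) :
    IntegrableOn (fun t : ℝ => t ^ (u - 1) * (1 - t) ^ (v - 1)) (Set.Ioc 0 1) := by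
  have h := Complex.betaIntegral_convergent (u := u) (v := v) (by simpa) (by simpa)
  rw [intervalIntegrable_iff_integrableOn_Ioc_of_le zero_le_one, integrableOn_Ioc_iff_integrableOn_Ioo]
    at h
  rw [integrableOn_Ioc_iff_integrableOn_Ioo]
  refine h.norm.congr ((ae_restrict_iff' measurableSet_Ioo).2 (.of_forall fun t ht => ?_))
  have h1 : 0 < 1 - t := sub_pos.2 ht.2
  have e : (1 : ℂ) - t = ((1 - t : ℝ) : ℂ) := by push_cast; rfl
  beta_reduce
  rw [norm_mul, e, Complex.norm_cpow_eq_rpow_re_of_pos ht.1, Complex.norm_cpow_eq_rpow_re_of_pos h1]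
  simp

theorem extCHF_integrand_nonneg (σ b c x : ℝ) {t : ℝ} (ht : t ∈ Set.Ioc (0 : ℝ) 1) :
    0 ≤ t ^ (b - 1) * (1 - t) ^ (c - b - 1) * exp (x * t - σ / (t * (1 - t))) :=
  mul_nonneg (mul_nonneg (rpow_nonneg ht.1.le _) (rpow_nonneg (sub_nonneg.2 ht.2) _)) (exp_nonneg _)

open MeasureTheory in
theorem integrableOn_extCHF_integrand {σ b c : ℝ} (x : ℝ) (hσ : 0 ≤ σ) (hb : 0 < b) (hbc : b < c) :
    IntegrableOn (fun t : ℝ => t ^ (b - 1) * (1 - t) ^ (c - b - 1) *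
      exp (x * t - σ / (t * (1 - t)))) (Set.Ioc 0 1) := by
  refine Integrable.mul_bdd (c := exp |x|)
    (integrableOn_rpow_mul_one_sub_rpow_s13 hb (sub_pos.2 hbc)) ?_ ?_
  · exact Measurable.aestronglyMeasurable (by fun_prop)
  · refine (ae_restrict_iff' measurableSet_Ioc).2 (.of_forall fun t ht => ?_)
    rw [norm_of_nonneg (exp_nonneg _), exp_le_exp]
    have h1 : 0 ≤ σ / (t * (1 - t)) := div_nonneg hσ (mul_nonneg ht.1.le (sub_nonneg.2 ht.2))
    have h2 : x * t ≤ |x| * 1 :=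
      mul_le_mul (le_abs_self x) ht.2 ht.1.le (abs_nonneg x)
    linarith

/-- The integrand of `extCHF` is log-affine in `σ`. -/
theorem extCHF_integrand_convexComb (σ₁ σ₂ x : ℝ) {α w t : ℝ} (hw : 0 ≤ w)
    (hα : α ∈ Set.Icc (0 : ℝ) 1) :
    w * exp (x * t - (α * σ₁ + (1 - α) * σ₂) / (t * (1 - t))) =
      (w * exp (x * t - σ₁ / (t * (1 - t)))) ^ α *
        (w * exp (x * t - σ₂ / (t * (1 - t)))) ^ (1 - α) := by
  have hw' : w ^ α * w ^ (1 - α) = w := by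
    rw [← rpow_add_of_nonneg hw hα.1 (sub_nonneg.2 hα.2), add_sub_cancel, rpow_one]
  rw [mul_rpow hw (exp_nonneg _), mul_rpow hw (exp_nonneg _), mul_mul_mul_comm, hw', ← exp_mul,
    ← exp_mul, ← exp_add]
  ring_nf

theorem classicalBeta_pos {u v : ℝ} (hu : 0 < u) (hv : 0 < v) : 0 < classicalBeta u v :=
  div_pos (mul_pos (Gamma_pos_of_pos hu) (Gamma_pos_of_pos hv)) (Gamma_pos_of_pos (add_pos hu hv))

/-- For fixed x, σ ↦ Φ_σ(b; c; x) is log-convex on (0, ∞). -/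
theorem extCHF_logConvex_in_sigma (b c x : ℝ) (hb : 0 < b) (hbc : b < c) :
    ∀ σ₁ σ₂ α : ℝ, 0 < σ₁ → 0 < σ₂ → α ∈ Set.Icc (0:ℝ) 1 →
      extCHF (α * σ₁ + (1 - α) * σ₂) b c x ≤
        extCHF σ₁ b c x ^ α * extCHF σ₂ b c x ^ (1 - α) := by
  intro σ₁ σ₂ α h₁ h₂ hα
  have hB : 0 ≤ 1 / classicalBeta b (c - b) :=
    (one_div_pos.2 (classicalBeta_pos hb (sub_pos.2 hbc))).le
  have hB' : (1 / classicalBeta b (c - b)) ^ α * (1 / classicalBeta b (c - b)) ^ (1 - α) =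
      1 / classicalBeta b (c - b) := by
    rw [← rpow_add_of_nonneg hB hα.1 (sub_nonneg.2 hα.2), add_sub_cancel, rpow_one]
  have nonneg_ae (σ : ℝ) := (MeasureTheory.ae_restrict_iff' (μ := MeasureTheory.volume)
    measurableSet_Ioc).2 (.of_forall fun t ht => extCHF_integrand_nonneg σ b c x (t := t) ht)
  simp only [extCHF, integral_of_le zero_le_one]
  rw [mul_rpow hB (MeasureTheory.integral_nonneg_of_ae (nonneg_ae σ₁)),
    mul_rpow hB (MeasureTheory.integral_nonneg_of_ae (nonneg_ae σ₂)), mul_mul_mul_comm, hB']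
  refine mul_le_mul_of_nonneg_left ?_ hB
  rw [MeasureTheory.setIntegral_congr_fun measurableSet_Ioc fun t ht =>
    extCHF_integrand_convexComb σ₁ σ₂ x
      (mul_nonneg (rpow_nonneg ht.1.le (b - 1)) (rpow_nonneg (sub_nonneg.2 ht.2) (c - b - 1))) hα]
  exact integral_rpow_mul_rpow_one_sub_le (integrableOn_extCHF_integrand x h₁.le hb hbc)
    (integrableOn_extCHF_integrand x h₂.le hb hbc) (nonneg_ae σ₁) (nonneg_ae σ₂) hα
end
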